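/- arXiv:1710.05165 — 3 statements merged into one kernel-verified Lean document; each statement's English description precedes it below -/
import Mathlib

section
/- For a uniformly random permutation σ of {1,...,n} and any subset T ⊆ {1,...,n}, the probability that σ has no cycle whose length belongs to T is at most exp(1 - H), where H = Σ_{k∈T} 1/k. -/
/-- The product of the parts of `m` and of the factorials of their multiplicities, inverted: when
`m` is a partition of `n`, the probability that a random permutation of `n` points has cycle
lengths `m`. -/
noncomputable def cycleWeight (m : Multiset ℕ) : ℝ :=
  ((m.prod * ∏ k ∈ m.toFinset, (m.count k).factorial : ℕ) : ℝ)⁻¹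

lemma cycleWeight_nonneg (m : Multiset ℕ) : 0 ≤ cycleWeight m := by
  unfold cycleWeight; positivity

lemma cycleWeight_eq_mul_cons {k : ℕ} (hk : 0 < k) (s : Multiset ℕ) :
    cycleWeight s = (k * (k ::ₘ s).count k : ℕ) * cycleWeight (k ::ₘ s) := by
  have hs : ∏ i ∈ s.toFinset, (s.count i).factorial
      = ∏ i ∈ (k ::ₘ s).toFinset, (s.count i).factorial := by
    refine Finset.prod_subset (by simp) fun i _ hi => ?_
    rw [Multiset.count_eq_zero_of_notMem (by simpa using hi), Nat.factorial_zero]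
  have hmem : k ∈ (k ::ₘ s).toFinset := by simp
  have hcongr : ∏ i ∈ (k ::ₘ s).toFinset.erase k, ((k ::ₘ s).count i).factorial
      = ∏ i ∈ (k ::ₘ s).toFinset.erase k, (s.count i).factorial :=
    Finset.prod_congr rfl fun i hi => by
      rw [Multiset.count_cons_of_ne (Finset.ne_of_mem_erase hi)]
  unfold cycleWeight
  rw [hs, ← Finset.mul_prod_erase _ _ hmem, ← Finset.mul_prod_erase _ _ hmem, hcongr,
    Multiset.prod_cons, Multiset.count_cons_self, Nat.factorial_succ]
  have hk' : (k : ℝ) ≠ 0 := by positivity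
  have hc : ((s.count k : ℝ) + 1) ≠ 0 := by positivity
  push_cast
  simp only [mul_inv]
  field_simp

lemma sum_mul_cycleWeight {m : Multiset ℕ} (hm : ∀ k ∈ m, 0 < k) :
    (m.sum : ℝ) * cycleWeight m = ∑ k ∈ m.toFinset, cycleWeight (m.erase k) := by
  conv_lhs => rw [Finset.sum_multiset_count m]
  rw [Nat.cast_sum, Finset.sum_mul]
  refine Finset.sum_congr rfl fun k hk => ?_
  rw [Multiset.mem_toFinset] at hk
  rw [cycleWeight_eq_mul_cons (hm k hk) (m.erase k), Multiset.cons_erase hk, smul_eq_mul, mul_comm k]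

/-- The multisets of positive integers outside `T` with sum `j`. -/
def partitionsAvoiding (T : Finset ℕ) (j : ℕ) : Finset (Multiset ℕ) :=
  {m ∈ (Finset.univ : Finset j.Partition).image Nat.Partition.parts | ∀ k ∈ m, k ∉ T}

lemma mem_partitionsAvoiding {T : Finset ℕ} {j : ℕ} {m : Multiset ℕ} :
    m ∈ partitionsAvoiding T j ↔ m.sum = j ∧ ∀ k ∈ m, 0 < k ∧ k ∉ T := by
  simp only [partitionsAvoiding, Finset.mem_filter, Finset.mem_image, Finset.mem_univ, true_and]
  constructor
  · rintro ⟨⟨l, rfl⟩, h⟩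
    exact ⟨l.parts_sum, fun k hk => ⟨l.parts_pos hk, h k hk⟩⟩
  · rintro ⟨hs, h⟩
    exact ⟨⟨⟨m, fun hk => (h _ hk).1, hs⟩, rfl⟩, fun k hk => (h k hk).2⟩

/-- The probability that a random permutation of `j` points has no cycle length in `T`. -/
noncomputable def avoidProb (T : Finset ℕ) (j : ℕ) : ℝ :=
  ∑ m ∈ partitionsAvoiding T j, cycleWeight m

lemma avoidProb_nonneg (T : Finset ℕ) (j : ℕ) : 0 ≤ avoidProb T j :=
  Finset.sum_nonneg fun m _ => cycleWeight_nonneg m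

lemma avoidProb_zero (T : Finset ℕ) : avoidProb T 0 = 1 := by
  have : partitionsAvoiding T 0 = {0} := by
    ext m
    rw [mem_partitionsAvoiding, Finset.mem_singleton]
    constructor
    · rintro ⟨hs, h⟩
      refine Multiset.eq_zero_of_forall_notMem fun k hk => ?_
      have := Multiset.le_sum_of_mem hk
      have := (h k hk).1
      omega
    · rintro rfl
      simp
  simp [avoidProb, this, cycleWeight]

lemma mul_avoidProb_le (T : Finset ℕ) (j : ℕ) :
    j * avoidProb T j ≤ ∑ k ∈ Finset.Icc 1 j \ T, avoidProb T (j - k) := by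
  have hexp : j * avoidProb T j = ∑ k ∈ Finset.Icc 1 j \ T,
      ∑ m ∈ partitionsAvoiding T j with k ∈ m, cycleWeight (m.erase k) := by
    rw [avoidProb, Finset.mul_sum]
    simp_rw [Finset.sum_filter]
    rw [Finset.sum_comm]
    refine Finset.sum_congr rfl fun m hm => ?_
    obtain ⟨rfl, hpos⟩ := mem_partitionsAvoiding.1 hm
    rw [sum_mul_cycleWeight fun k hk => (hpos k hk).1, ← Finset.sum_filter]
    refine Finset.sum_congr ?_ fun _ _ => rfl
    ext k
    simp only [Multiset.mem_toFinset, Finset.mem_filter, Finset.mem_sdiff, Finset.mem_Icc]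
    exact ⟨fun hk => ⟨⟨⟨(hpos k hk).1, Multiset.le_sum_of_mem hk⟩, (hpos k hk).2⟩, hk⟩, fun h => h.2⟩
  rw [hexp]
  refine Finset.sum_le_sum fun k _ => ?_
  have hinj : Set.InjOn (fun m : Multiset ℕ => m.erase k)
      ({m ∈ partitionsAvoiding T j | k ∈ m} : Finset (Multiset ℕ)) := by
    intro a ha b hb hab
    simp only [Finset.coe_filter, Set.mem_ofPred_eq] at ha hb
    rw [← Multiset.cons_erase ha.2, ← Multiset.cons_erase hb.2]
    exact congrArg _ hab
  rw [← Finset.sum_image (f := cycleWeight) hinj]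
  refine Finset.sum_le_sum_of_subset_of_nonneg ?_ fun m _ _ => cycleWeight_nonneg m
  intro s hs
  obtain ⟨m, hm, rfl⟩ := Finset.mem_image.1 hs
  obtain ⟨hm, hk⟩ := Finset.mem_filter.1 hm
  obtain ⟨hsum, hm⟩ := mem_partitionsAvoiding.1 hm
  refine mem_partitionsAvoiding.2 ⟨?_, fun i hi => hm i (Multiset.mem_of_mem_erase hi)⟩
  have := Multiset.sum_erase hk
  omega

/-- If `p_0 = 1` and `j p_j ≤ ∑ p_{j-k}` over the `k ∉ T` in `{1,...,j}`, then
`p_0 + ... + p_{n-1}` is at most the exponential of `∑ 1/k` over the `k ∉ T` in `{1,...,n}`. -/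
lemma sum_range_le_exp_of_mul_le {p : ℕ → ℝ} (hp : ∀ j, 0 ≤ p j) (hp0 : p 0 = 1) {T : Finset ℕ}
    (hrec : ∀ j : ℕ, j * p j ≤ ∑ k ∈ Finset.Icc 1 j \ T, p (j - k)) (n : ℕ) :
    ∑ j ∈ Finset.range n, p j ≤ Real.exp (∑ k ∈ Finset.Icc 1 n \ T, (1 : ℝ) / k) := by
  set A := Finset.Icc 1 n \ T with hA
  let F : ℝ → ℝ := fun x => ∑ j ∈ Finset.range n, p j * x ^ j
  let L : ℝ → ℝ := fun x => ∑ k ∈ A, x ^ k / k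
  let F' : ℝ → ℝ := fun x => ∑ j ∈ Finset.range n, p j * (j * x ^ (j - 1))
  let L' : ℝ → ℝ := fun x => ∑ k ∈ A, x ^ (k - 1)
  have hApos : ∀ k ∈ A, 1 ≤ k := fun k hk => by
    simp only [hA, Finset.mem_sdiff, Finset.mem_Icc] at hk
    exact hk.1.1
  have hF (x : ℝ) : HasDerivAt F (F' x) x :=
    HasDerivAt.fun_sum fun j _ => (hasDerivAt_pow j x).const_mul (p j)
  have hL (x : ℝ) : HasDerivAt L (L' x) x := by
    refine HasDerivAt.fun_sum fun k hk => ?_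
    have hk0 : (k : ℝ) ≠ 0 := by have := hApos k hk; positivity
    convert! (hasDerivAt_pow k x).div_const (k : ℝ) using 1
    field_simp
  have hFL {x : ℝ} (hx : 0 ≤ x) : F' x ≤ L' x * F x := by
    calc F' x ≤ ∑ j ∈ Finset.range n, ∑ k ∈ A with k ≤ j,
            x ^ (k - 1) * (p (j - k) * x ^ (j - k)) := by
          refine Finset.sum_le_sum fun j hj => ?_
          have hset : {k ∈ A | k ≤ j} = Finset.Icc 1 j \ T := by
            ext k
            have := Finset.mem_range.1 hj
            simp only [hA, Finset.mem_filter, Finset.mem_sdiff, Finset.mem_Icc]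
            constructor
            · tauto
            · rintro ⟨⟨h1, h2⟩, h3⟩
              exact ⟨⟨⟨h1, by omega⟩, h3⟩, h2⟩
          rw [hset]
          calc p j * (j * x ^ (j - 1)) = j * p j * x ^ (j - 1) := by ring
            _ ≤ (∑ k ∈ Finset.Icc 1 j \ T, p (j - k)) * x ^ (j - 1) := by
                gcongr; exact hrec j
            _ = _ := by
                rw [Finset.sum_mul]
                refine Finset.sum_congr rfl fun k hk => ?_
                simp only [Finset.mem_sdiff, Finset.mem_Icc] at hk
                rw [show j - 1 = (k - 1) + (j - k) by omega, pow_add]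
                ring
      _ = ∑ k ∈ A, ∑ j ∈ Finset.range n with k ≤ j, x ^ (k - 1) * (p (j - k) * x ^ (j - k)) := by
          simp_rw [Finset.sum_filter]
          rw [Finset.sum_comm]
      _ ≤ ∑ k ∈ A, x ^ (k - 1) * F x := by
          refine Finset.sum_le_sum fun k _ => ?_
          rw [← Finset.mul_sum]
          gcongr
          have hinj : Set.InjOn (fun j => j - k) ({j ∈ Finset.range n | k ≤ j} : Finset ℕ) := by
            intro a ha b hb hab
            simp only [Finset.coe_filter, Set.mem_ofPred_eq] at ha hb hab
            omega
          rw [← Finset.sum_image (f := fun i => p i * x ^ i) hinj]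
          refine Finset.sum_le_sum_of_subset_of_nonneg ?_ fun i _ _ =>
            mul_nonneg (hp i) (pow_nonneg hx i)
          intro i hi
          simp only [Finset.mem_image, Finset.mem_filter, Finset.mem_range] at hi ⊢
          omega
      _ = L' x * F x := by rw [Finset.sum_mul]
  rcases Nat.eq_zero_or_pos n with rfl | hn
  · simpa using (Real.exp_pos _).le
  have hG (x : ℝ) : HasDerivAt (fun x => F x * Real.exp (-L x))
      (F' x * Real.exp (-L x) + F x * (Real.exp (-L x) * -L' x)) x :=
    (hF x).mul (hL x).neg.exp
  have hanti : AntitoneOn (fun x => F x * Real.exp (-L x)) (Set.Ici 0) := by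
    refine antitoneOn_of_deriv_nonpos (convex_Ici 0)
      (fun x _ => (hG x).continuousAt.continuousWithinAt)
      (fun x _ => (hG x).differentiableAt.differentiableWithinAt) fun x hx => ?_
    rw [interior_Ici] at hx
    rw [(hG x).deriv]
    nlinarith [hFL (le_of_lt hx), Real.exp_pos (-L x)]
  have h01 := hanti (Set.mem_Ici.2 le_rfl) (Set.mem_Ici.2 zero_le_one) zero_le_one
  have hL0 : L 0 = 0 := Finset.sum_eq_zero fun k hk => by
    rw [zero_pow (by have := hApos k hk; omega), zero_div]
  have hF0 : F 0 = 1 := by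
    change ∑ j ∈ Finset.range n, p j * 0 ^ j = 1
    rw [Finset.sum_eq_single 0]
    · simp [hp0]
    · intro j _ hj
      simp [hj]
    · intro h
      simp at h
      omega
  simp only [hL0, hF0, Real.exp_neg, neg_zero, Real.exp_zero, mul_one] at h01
  have h1 : F 1 ≤ Real.exp (L 1) := by
    rwa [← div_eq_mul_inv, div_le_one (Real.exp_pos _)] at h01
  simpa [F, L] using h1

lemma avoidProb_le_exp {n : ℕ} {T : Finset ℕ} (hT : T ⊆ Finset.Icc 1 n) :
    avoidProb T n ≤ Real.exp (1 - ∑ k ∈ T, (1 : ℝ) / k) := by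
  rcases Nat.eq_zero_or_pos n with rfl | hn
  · obtain rfl : T = ∅ := by simpa using hT
    rw [avoidProb_zero]
    simp
  have hn' : (0 : ℝ) < n := by exact_mod_cast hn
  have hharm : ∑ k ∈ Finset.Icc 1 n, (1 : ℝ) / k ≤ 1 + Real.log n := by
    have := harmonic_le_one_add_log n
    rw [harmonic_eq_sum_Icc] at this
    push_cast at this
    simpa only [one_div] using this
  have hsub : ∑ k ∈ Finset.Icc 1 n \ T, avoidProb T (n - k)
      ≤ ∑ j ∈ Finset.range n, avoidProb T j := by
    have hinj : Set.InjOn (fun k => n - k) (Finset.Icc 1 n \ T : Finset ℕ) := by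
      intro a ha b hb hab
      simp only [Finset.coe_sdiff, Finset.coe_Icc, Set.mem_sdiff, Set.mem_Icc] at ha hb hab
      omega
    rw [← Finset.sum_image (f := avoidProb T) hinj]
    refine Finset.sum_le_sum_of_subset_of_nonneg ?_ fun j _ _ => avoidProb_nonneg T j
    intro j hj
    simp only [Finset.mem_image, Finset.mem_sdiff, Finset.mem_Icc, Finset.mem_range] at hj ⊢
    omega
  have hmain : n * avoidProb T n ≤ n * Real.exp (1 - ∑ k ∈ T, (1 : ℝ) / k) :=
    calc n * avoidProb T n ≤ Real.exp (∑ k ∈ Finset.Icc 1 n \ T, (1 : ℝ) / k) :=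
          (mul_avoidProb_le T n).trans <| hsub.trans <|
            sum_range_le_exp_of_mul_le (avoidProb_nonneg T) (avoidProb_zero T)
              (mul_avoidProb_le T) n
      _ ≤ Real.exp (Real.log n + (1 - ∑ k ∈ T, (1 : ℝ) / k)) := by
          have := Finset.sum_sdiff (f := fun k : ℕ => (1 : ℝ) / k) hT
          gcongr
          linarith
      _ = n * Real.exp (1 - ∑ k ∈ T, (1 : ℝ) / k) := by rw [Real.exp_add, Real.exp_log hn']
  exact le_of_mul_le_mul_left hmain hn'

namespace Equiv.Perm

variable {α : Type*} [Fintype α] [DecidableEq α]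

lemma exists_minimalPeriod_eq_of_mem_parts_partition {σ : Perm α} {k : ℕ}
    (hk : k ∈ σ.partition.parts) : ∃ x, Function.minimalPeriod σ x = k := by
  rw [parts_partition, Multiset.mem_add] at hk
  rcases hk with hk | hk
  · rw [cycleType_def, Multiset.mem_map] at hk
    obtain ⟨c, hc, rfl⟩ := hk
    have hc' : c ∈ σ.cycleFactorsFinset := hc
    have hcyc := (mem_cycleFactorsFinset_iff.1 hc').1
    obtain ⟨x, hx⟩ := hcyc.nonempty_support
    refine ⟨x, ?_⟩
    have hcx : c = σ.cycleOf x := cycle_is_cycleOf hx hc'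
    refine Nat.dvd_right_iff_eq.1 fun i => ?_
    rw [Function.comp_apply, ← hcyc.orderOf, orderOf_dvd_iff_pow_eq_one,
      hcyc.pow_eq_one_iff' (mem_support.1 hx), ← Function.isPeriodicPt_iff_minimalPeriod_dvd,
      Function.IsPeriodicPt, Function.IsFixedPt, iterate_eq_pow, hcx, cycleOf_pow_apply_self]
  · obtain ⟨hne, rfl⟩ := Multiset.mem_replicate.1 hk
    have : ∃ x, x ∉ σ.support := by
      by_contra! h
      rw [Finset.eq_univ_iff_forall.2 h, Finset.card_univ] at hne
      omega
    obtain ⟨x, hx⟩ := this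
    exact ⟨x, Function.minimalPeriod_eq_one_iff_isFixedPt.2 (notMem_support.1 hx)⟩

lemma card_parts_partition_le (m : Multiset ℕ) :
    (Finset.card {σ : Perm α | σ.partition.parts = m} : ℝ)
      ≤ (Fintype.card α).factorial * cycleWeight m := by
  rcases Finset.eq_empty_or_nonempty {σ : Perm α | σ.partition.parts = m} with h | ⟨τ, hτ⟩
  · rw [h, Finset.card_empty, Nat.cast_zero]
    exact mul_nonneg (Nat.cast_nonneg _) (cycleWeight_nonneg m)
  simp only [Finset.mem_filter, Finset.mem_univ, true_and] at hτ
  have hle : Finset.card {σ : Perm α | σ.partition.parts = m}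
      ≤ Finset.card {σ : Perm α | σ.cycleType = τ.cycleType} := by
    refine Finset.card_le_card fun σ hσ => ?_
    simp only [Finset.mem_filter, Finset.mem_univ, true_and] at hσ ⊢
    rw [← filter_parts_partition_eq_cycleType, hσ, ← hτ, filter_parts_partition_eq_cycleType]
  set f := Fintype.card α - τ.cycleType.sum with hf
  have hm : m = τ.cycleType + Multiset.replicate f 1 := by
    rw [← hτ, parts_partition, hf, sum_cycleType]
  have h1 : 1 ∉ τ.cycleType := fun h => lt_irrefl _ (one_lt_of_mem_cycleType h)
  have hprod : ∏ k ∈ m.toFinset, (m.count k).factorial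
      = f.factorial * ∏ k ∈ τ.cycleType.toFinset, (τ.cycleType.count k).factorial := by
    have hsub : m.toFinset ⊆ insert 1 τ.cycleType.toFinset := by
      intro k hk
      rw [hm] at hk
      simp only [Multiset.toFinset_add, Finset.mem_union, Multiset.mem_toFinset,
        Multiset.mem_replicate, Finset.mem_insert] at hk ⊢
      tauto
    rw [Finset.prod_subset hsub fun k _ hk => by
      rw [Multiset.count_eq_zero_of_notMem (by simpa using hk), Nat.factorial_zero]]
    rw [Finset.prod_insert (by simpa using h1), hm]
    congr 1
    · rw [Multiset.count_add, Multiset.count_eq_zero_of_notMem h1, Multiset.count_replicate_self,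
        zero_add]
    · refine Finset.prod_congr rfl fun k hk => ?_
      have hk1 : 1 ≠ k := by
        rintro rfl
        exact h1 (by simpa using hk)
      rw [Multiset.count_add, Multiset.count_replicate, if_neg hk1, add_zero]
  have hcard := card_of_cycleType_mul_eq α τ.cycleType
  rw [if_pos ⟨sum_cycleType_le τ, fun _ => two_le_of_mem_cycleType⟩, ← hf] at hcard
  have hden : m.prod * ∏ k ∈ m.toFinset, (m.count k).factorial
      = f.factorial * τ.cycleType.prod
        * ∏ k ∈ τ.cycleType.toFinset, (τ.cycleType.count k).factorial := by
    rw [hprod, hm, Multiset.prod_add, Multiset.prod_replicate, one_pow]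
    ring
  have hpos : 0 < m.prod * ∏ k ∈ m.toFinset, (m.count k).factorial := by
    have : 0 < m.prod := Multiset.prod_pos fun k hk => τ.partition.parts_pos (hτ ▸ hk)
    positivity
  rw [cycleWeight, ← div_eq_mul_inv, le_div_iff₀ (by exact_mod_cast hpos), ← hcard, ← hden]
  exact_mod_cast Nat.mul_le_mul_right _ hle

lemma card_minimalPeriod_notMem_le (T : Finset ℕ) :
    (Nat.card {σ : Perm α // ∀ x, Function.minimalPeriod σ x ∉ T} : ℝ)
      ≤ (Fintype.card α).factorial * avoidProb T (Fintype.card α) := by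
  classical
  have hmaps : ∀ σ ∈ ({σ : Perm α | ∀ x, Function.minimalPeriod σ x ∉ T} : Finset (Perm α)),
      σ.partition.parts ∈ partitionsAvoiding T (Fintype.card α) := by
    intro σ hσ
    simp only [Finset.mem_filter, Finset.mem_univ, true_and] at hσ
    refine mem_partitionsAvoiding.2 ⟨σ.partition.parts_sum, fun k hk =>
      ⟨σ.partition.parts_pos hk, ?_⟩⟩
    obtain ⟨x, rfl⟩ := exists_minimalPeriod_eq_of_mem_parts_partition hk
    exact hσ x
  rw [Nat.card_eq_fintype_card, Fintype.card_subtype, Finset.card_eq_sum_card_fiberwise hmaps,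
    Nat.cast_sum, avoidProb, Finset.mul_sum]
  refine Finset.sum_le_sum fun m _ => le_trans ?_ (card_parts_partition_le (α := α) m)
  exact_mod_cast Finset.card_le_card (Finset.filter_subset_filter _ (Finset.filter_subset _ _))

end Equiv.Perm

/-- For a uniformly random permutation `σ` of `{1,...,n}` and any `T ⊆ {1,...,n}`, the
probability that `σ` has no cycle whose length lies in `T` is at most `exp(1 - H)` where
`H = ∑_{k ∈ T} 1/k`.  A cycle of length `k` means a point whose minimal period under `σ`
is `k`. -/
theorem stmt1 (n : ℕ) (T : Finset ℕ) (hT : T ⊆ Finset.Icc 1 n) :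
    (Nat.card {σ : Equiv.Perm (Fin n) //
        ∀ x, Function.minimalPeriod σ x ∉ T} : ℝ)
      / (Nat.card (Equiv.Perm (Fin n)))
      ≤ Real.exp (1 - ∑ k ∈ T, (1 : ℝ) / k) := by
  rw [Nat.card_perm, Nat.card_eq_fintype_card (α := Fin n), Fintype.card_fin,
    div_le_iff₀ (by positivity), mul_comm (Real.exp _)]
  have h := Equiv.Perm.card_minimalPeriod_notMem_le (α := Fin n) T
  rw [Fintype.card_fin] at h
  exact h.trans (mul_le_mul_of_nonneg_left (avoidProb_le_exp hT) (by positivity))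
end

section
/- Let G ≤ Sₙ be a primitive permutation group with G not containing the alternating group Aₙ. Then the minimal degree of G is at least (√n − 1)/2, where the minimal degree is the minimum over nonidentity g ∈ G of the number of points moved by g. -/
namespace PrimitiveGroup

open Finset
open Equiv (Perm)

theorem perm_apply_inv_apply {α : Type*} (g : Perm α) (x : α) : g (g⁻¹ x) = x :=
  g.apply_symm_apply x

theorem perm_inv_apply_apply {α : Type*} (g : Perm α) (x : α) : g⁻¹ (g x) = x :=
  g.symm_apply_apply x

/-- Double counting for a finite group preserving `V` and transitive on it: the mean size of
`U ∩ h⁻¹ • U`, for `U ⊆ V`, is `|U|² / |V|`. -/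
theorem sum_card_smul_mem_mul_card {Γ β : Type*} [Group Γ] [Fintype Γ] [MulAction Γ β]
    [DecidableEq β] (U V : Finset β) (hUV : U ⊆ V) (hV : ∀ h : Γ, ∀ u ∈ V, h • u ∈ V)
    (htrans : ∀ u ∈ V, ∀ v ∈ V, ∃ h : Γ, h • u = v) :
    (∑ h : Γ, #{u ∈ U | h • u ∈ U}) * #V = #U * #U * Fintype.card Γ := by
  rcases V.eq_empty_or_nonempty with rfl | ⟨w, hw⟩
  · simp [subset_empty.mp hUV]
  have hconst : ∀ u ∈ V, ∀ v ∈ V, #{h : Γ | h • u = v} = #{h : Γ | h • w = w} := by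
    intro u hu v hv
    obtain ⟨k, hk⟩ := htrans v hv w hw
    obtain ⟨l, hl⟩ := htrans w hw u hu
    refine card_bij' (fun h _ => k * h * l) (fun h _ => k⁻¹ * h * l⁻¹) ?_ ?_ ?_ ?_
    · intro h hh
      simp only [mem_filter, mem_univ, true_and] at hh ⊢
      rw [mul_smul, mul_smul, hl, hh, hk]
    · intro h hh
      simp only [mem_filter, mem_univ, true_and] at hh ⊢
      rw [mul_smul, mul_smul, ← hl, inv_smul_smul, hh, ← hk, inv_smul_smul]
    · intro h _
      group
    · intro h _
      group
  have hcard : Fintype.card Γ = #V * #{h : Γ | h • w = w} := by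
    rw [← card_univ, card_eq_sum_card_fiberwise (f := fun h : Γ => h • w) (t := V)
      (fun h _ => hV h w hw), sum_congr rfl (fun v hv => hconst w hw v hv), sum_const,
      smul_eq_mul]
  have hsum : ∑ h : Γ, #{u ∈ U | h • u ∈ U} = #U * #U * #{h : Γ | h • w = w} := by
    have hcomm := sum_card_bipartiteAbove_eq_sum_card_bipartiteBelow
      (s := (univ : Finset Γ)) (t := U) (fun h u => h • u ∈ U)
    simp only [bipartiteAbove, bipartiteBelow] at hcomm
    rw [hcomm, mul_assoc, ← smul_eq_mul, ← sum_const]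
    refine sum_congr rfl fun u hu => ?_
    rw [card_eq_sum_card_fiberwise (f := fun h : Γ => h • u) (t := U)
      (fun h hh => by simpa using hh), ← smul_eq_mul, ← sum_const]
    refine sum_congr rfl fun v hv => ?_
    rw [← hconst u (hUV hu) v (hUV hv), filter_filter]
    congr 1
    ext h
    simp only [mem_filter, mem_univ, true_and, and_iff_right_iff_imp]
    rintro rfl
    exact hv
  rw [hsum, hcard]
  ring

variable {α : Type*} [Fintype α] [DecidableEq α]

/-- The commutator of two permutations whose supports meet in one point is a 3-cycle. -/
theorem isThreeCycle_commutator_of_support_inter {g k : Perm α} {p : α}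
    (h : g.support ∩ k.support = {p}) : (g * k * g⁻¹ * k⁻¹).IsThreeCycle := by
  have hmem : ∀ x, (g x ≠ x ∧ k x ≠ x) ↔ x = p := by
    intro x
    simpa using congrArg (x ∈ ·) h
  have hp := (hmem p).mpr rfl
  have hfix : ∀ x, x ≠ p → g x = x ∨ k x = x := by
    intro x hx
    have := (hmem x).not.mpr hx
    tauto
  have hginv : g⁻¹ p ≠ p := fun e => hp.1 (Perm.inv_eq_iff_eq.mp e).symm
  have hle : (g * k * g⁻¹ * k⁻¹).support ⊆ {p, g p, k p} := by
    intro x hx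
    contrapose! hx
    simp only [mem_insert, mem_singleton, not_or] at hx
    obtain ⟨hxp, hxg, hxk⟩ := hx
    rw [Perm.notMem_support]
    simp only [Perm.mul_apply]
    have hkx : k⁻¹ x ≠ p := fun e => hxk (Perm.inv_eq_iff_eq.mp e)
    have hgx : g⁻¹ x ≠ p := fun e => hxg (Perm.inv_eq_iff_eq.mp e)
    by_cases hk : k x = x
    · rw [Perm.inv_eq_iff_eq.mpr hk.symm]
      rcases hfix _ hgx with e | e
      · rw [perm_apply_inv_apply] at e
        rw [← e, hk]
        exact (Perm.inv_eq_iff_eq.mp e.symm).symm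
      · rw [e, perm_apply_inv_apply]
    · have e : g (k⁻¹ x) = k⁻¹ x := by
        rcases hfix _ hkx with e | e
        · exact e
        · rw [perm_apply_inv_apply] at e
          exact absurd (Perm.inv_eq_iff_eq.mp e.symm).symm hk
      rw [Perm.inv_eq_iff_eq.mpr e.symm, perm_apply_inv_apply]
      exact (hfix x hxp).resolve_right hk
  have hne : g * k * g⁻¹ * k⁻¹ ≠ 1 := by
    intro e
    have e' := congrArg (fun f : Perm α => f (k p)) e
    simp only [Perm.mul_apply, perm_inv_apply_apply, Perm.one_apply] at e'
    rcases hfix _ hginv with e1 | e1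
    · rw [perm_apply_inv_apply] at e1
      exact hginv e1.symm
    · rw [e1, perm_apply_inv_apply] at e'
      exact hp.2 e'.symm
  rw [← card_support_eq_three_iff]
  have h3 : #(g * k * g⁻¹ * k⁻¹).support ≤ 3 := (card_le_card hle).trans card_le_three
  have h2 := Perm.two_le_card_support_of_ne_one hne
  have hn2 : #(g * k * g⁻¹ * k⁻¹).support ≠ 2 := by
    intro e
    have hs := (Perm.card_support_eq_two.mp e).sign_eq
    rw [← commutatorElement_def, map_commutatorElement, commutatorElement_eq_one_iff_mul_comm.mpr
      (mul_comm _ _)] at hs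
    exact absurd hs (by decide)
  omega

/-- A set that is not too large compared with the degree of a doubly transitive group meets some
translate of itself in exactly one point. -/
theorem exists_card_filter_mem_eq_one {G : Subgroup (Perm α)}
    (h1 : ∀ a c : α, ∃ h ∈ G, h a = c)
    (h2 : ∀ a b c d : α, a ≠ b → c ≠ d → ∃ h ∈ G, h a = c ∧ h b = d)
    {S : Finset α} (hS : S.Nonempty) (hcard : (#S - 1) ^ 2 + 1 < Fintype.card α) :
    ∃ h ∈ G, #{s ∈ S | h s ∈ S} = 1 := by
  classical
  by_contra! hno
  have e1 := sum_card_smul_mem_mul_card (Γ := G) S univ (subset_univ _)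
    (fun _ _ _ => mem_univ _)
    (fun u _ v _ => by obtain ⟨h, hG, e⟩ := h1 u v; exact ⟨⟨h, hG⟩, e⟩)
  have e2 := sum_card_smul_mem_mul_card (Γ := G) S.offDiag univ.offDiag
    (offDiag_mono (subset_univ _)) (by simp [Subgroup.smul_def])
    (by
      rintro ⟨a, b⟩ hab ⟨c, d⟩ hcd
      obtain ⟨h, hG, ha, hb⟩ := h2 a b c d (by simpa using hab) (by simpa using hcd)
      exact ⟨⟨h, hG⟩, Prod.ext ha hb⟩)
  have hle : ∑ h : G, #{u ∈ S | h • u ∈ S} ≤ ∑ h : G, #{u ∈ S.offDiag | h • u ∈ S.offDiag} := by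
    refine sum_le_sum fun h _ => ?_
    have hoff : ({u ∈ S.offDiag | h • u ∈ S.offDiag} : Finset (α × α)) =
        ({u ∈ S | h • u ∈ S} : Finset α).offDiag := by
      ext ⟨a, b⟩
      simp only [mem_filter, mem_offDiag, Prod.smul_mk, ne_eq, smul_left_cancel_iff]
      tauto
    have hX : #{u ∈ S | h • u ∈ S} ≠ 1 := hno h h.2
    rw [hoff, offDiag_card]
    generalize #{u ∈ S | h • u ∈ S} = X at hX ⊢
    rcases X with _ | _ | X
    · simp
    · simp at hX
    · refine Nat.le_sub_of_add_le ?_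
      nlinarith
  simp only [offDiag_card, card_univ] at e1 e2
  have hN : 0 < Fintype.card G := Fintype.card_pos
  have hm : 0 < #S := hS.card_pos
  generalize Fintype.card α = n at *
  obtain ⟨m, hm'⟩ : ∃ m, #S = m + 1 := ⟨#S - 1, by omega⟩
  obtain ⟨l, rfl⟩ : ∃ l, n = l + 1 := ⟨n - 1, by omega⟩
  rw [hm'] at e1 e2 hcard
  rw [show (l + 1) * (l + 1) - (l + 1) = (l + 1) * l by
    rw [Nat.mul_succ, Nat.add_sub_cancel]] at e2
  rw [show (m + 1) * (m + 1) - (m + 1) = (m + 1) * m by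
    rw [Nat.mul_succ, Nat.add_sub_cancel]] at e2
  simp only [Nat.add_sub_cancel] at hcard
  have hml : m ^ 2 < l := by omega
  have hfin : (m + 1) * (m + 1) * Fintype.card G * l ≤
      (m + 1) * (m + 1) * Fintype.card G * m ^ 2 := by
    calc (m + 1) * (m + 1) * Fintype.card G * l
        = (∑ h : G, #{u ∈ S | h • u ∈ S}) * ((l + 1) * l) := by rw [← e1]; ring
      _ ≤ (∑ h : G, #{u ∈ S.offDiag | h • u ∈ S.offDiag}) * ((l + 1) * l) :=
          Nat.mul_le_mul_right _ hle
      _ = (m + 1) * (m + 1) * Fintype.card G * m ^ 2 := by rw [e2]; ring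
  exact absurd (Nat.le_of_mul_le_mul_left hfin (by positivity)) (by omega)

/-- A doubly transitive group containing a nonidentity element of small degree contains the
alternating group. -/
theorem alternatingGroup_le_of_two_transitive {G : Subgroup (Perm α)}
    (hprim : MulAction.IsPreprimitive G α)
    (h1 : ∀ a c : α, ∃ h ∈ G, h a = c)
    (h2 : ∀ a b c d : α, a ≠ b → c ≠ d → ∃ h ∈ G, h a = c ∧ h b = d)
    {g : Perm α} (hg : g ∈ G) (hg1 : g ≠ 1)
    (hcard : (#g.support - 1) ^ 2 + 1 < Fintype.card α) : alternatingGroup α ≤ G := by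
  have hne : g.support.Nonempty := by
    rw [nonempty_iff_ne_empty]
    simpa using hg1
  obtain ⟨h, hG, hX⟩ := exists_card_filter_mem_eq_one h1 h2 hne hcard
  obtain ⟨s, hs⟩ := card_eq_one.mp hX
  have hinter : g.support ∩ (h⁻¹ * g * h).support = {s} := by
    rw [← hs]
    ext x
    simp only [mem_inter, mem_filter, Perm.mem_support, Perm.mul_apply, ne_eq,
      Perm.inv_eq_iff_eq]
  have hk : h⁻¹ * g * h ∈ G := G.mul_mem (G.mul_mem (G.inv_mem hG) hg) hG
  exact Perm.alternatingGroup_le_of_isPreprimitive_of_isThreeCycle_mem hprim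
    (isThreeCycle_commutator_of_support_inter hinter)
    (G.mul_mem (G.mul_mem (G.mul_mem hg hk) (G.inv_mem hg)) (G.inv_mem hk))

/-- The points `c` such that `(c, x)` and `(c, y)` lie in different orbitals of `G`. -/
noncomputable def distinguishers (G : Subgroup (Perm α)) (x y : α) : Finset α :=
  open Classical in {c | ∀ h ∈ G, h c = c → h x ≠ y}

/-- The out-neighbours of `x` in the orbital of `G` containing `(a, b)`. -/
noncomputable def orbitalNeighbors (G : Subgroup (Perm α)) (a b x : α) : Finset α :=
  open Classical in {y | ∃ h ∈ G, h a = x ∧ h b = y}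

variable {G : Subgroup (Perm α)}

theorem mem_distinguishers {x y c : α} :
    c ∈ distinguishers G x y ↔ ∀ h ∈ G, h c = c → h x ≠ y := by
  simp [distinguishers]

theorem notMem_distinguishers {x y c : α} :
    c ∉ distinguishers G x y ↔ ∃ h ∈ G, h c = c ∧ h x = y := by
  simp [distinguishers]

theorem mem_orbitalNeighbors {a b x y : α} :
    y ∈ orbitalNeighbors G a b x ↔ ∃ h ∈ G, h a = x ∧ h b = y := by
  simp [orbitalNeighbors]

theorem distinguishers_comm (x y : α) : distinguishers G x y = distinguishers G y x := by
  suffices ∀ x y, distinguishers G x y ⊆ distinguishers G y x from (this x y).antisymm (this y x)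
  intro x y c hc
  contrapose! hc
  obtain ⟨h, hG, hc', e⟩ := notMem_distinguishers.mp hc
  exact notMem_distinguishers.mpr
    ⟨h⁻¹, G.inv_mem hG, Perm.inv_eq_iff_eq.mpr hc'.symm, Perm.inv_eq_iff_eq.mpr e.symm⟩

theorem distinguishers_subset_union (x y z : α) :
    distinguishers G x z ⊆ distinguishers G x y ∪ distinguishers G y z := by
  intro c hc
  contrapose! hc
  rw [mem_union, not_or, notMem_distinguishers, notMem_distinguishers] at hc
  obtain ⟨⟨h, hG, hc, e⟩, k, kG, kc, e'⟩ := hc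
  exact notMem_distinguishers.mpr
    ⟨k * h, G.mul_mem kG hG, by rw [Perm.mul_apply, hc, kc], by rw [Perm.mul_apply, e, e']⟩

theorem card_distinguishers_triangle (x y z : α) :
    #(distinguishers G x z) ≤ #(distinguishers G x y) + #(distinguishers G y z) :=
  (card_le_card (distinguishers_subset_union x y z)).trans (card_union_le _ _)

theorem card_distinguishers_apply {h : Perm α} (hG : h ∈ G) (x y : α) :
    #(distinguishers G (h x) (h y)) = #(distinguishers G x y) := by
  refine (card_equiv h fun c => ?_).symm
  rw [← not_iff_not, notMem_distinguishers, notMem_distinguishers]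
  constructor
  · rintro ⟨k, kG, kc, kx⟩
    exact ⟨h * k * h⁻¹, G.mul_mem (G.mul_mem hG kG) (G.inv_mem hG), by simp [kc], by simp [kx]⟩
  · rintro ⟨k, kG, kc, kx⟩
    refine ⟨h⁻¹ * k * h, G.mul_mem (G.mul_mem (G.inv_mem hG) kG) hG, ?_, ?_⟩ <;>
      simp [Perm.mul_apply, kc, kx]

theorem distinguishers_apply_subset_support {g : Perm α} (hg : g ∈ G) (a : α) :
    distinguishers G a (g a) ⊆ g.support := by
  intro c hc
  rw [Perm.mem_support]
  intro e
  exact mem_distinguishers.mp hc g hg e rfl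

theorem card_distinguishers_of_mem_orbitalNeighbors {a b x y : α}
    (h : y ∈ orbitalNeighbors G a b x) :
    #(distinguishers G x y) = #(distinguishers G a b) := by
  obtain ⟨k, kG, rfl, rfl⟩ := mem_orbitalNeighbors.mp h
  exact card_distinguishers_apply kG a b

theorem apply_mem_orbitalNeighbors {h : Perm α} (hG : h ∈ G) {a b x y : α}
    (hy : y ∈ orbitalNeighbors G a b x) : h y ∈ orbitalNeighbors G a b (h x) := by
  obtain ⟨k, kG, rfl, rfl⟩ := mem_orbitalNeighbors.mp hy
  exact mem_orbitalNeighbors.mpr ⟨h * k, G.mul_mem hG kG, rfl, rfl⟩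

theorem card_orbitalNeighbors (h1 : ∀ a c : α, ∃ h ∈ G, h a = c) (a b x y : α) :
    #(orbitalNeighbors G a b x) = #(orbitalNeighbors G a b y) := by
  obtain ⟨h, hG, rfl⟩ := h1 x y
  refine card_equiv h fun c => ⟨apply_mem_orbitalNeighbors hG, fun hc => ?_⟩
  simpa using apply_mem_orbitalNeighbors (G.inv_mem hG) hc

/-- If `c` does not distinguish `x` and `y`, then `x` and `y` are out-neighbours of `c` in the
same orbitals. -/
theorem mem_distinguishers_of_orbitalNeighbors {a b x y c : α}
    (hx : x ∈ orbitalNeighbors G a b c) (hy : y ∉ orbitalNeighbors G a b c) :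
    c ∈ distinguishers G x y := by
  contrapose! hy
  obtain ⟨h, hG, hc, rfl⟩ := notMem_distinguishers.mp hy
  simpa [hc] using apply_mem_orbitalNeighbors hG hx

theorem two_mul_card_orbitalNeighbors_le (h1 : ∀ a c : α, ∃ h ∈ G, h a = c) {a b x y : α}
    (hdisj : Disjoint (orbitalNeighbors G a b x) (orbitalNeighbors G a b y)) (z : α) :
    2 * #(orbitalNeighbors G a b z) ≤ #(distinguishers G x y) := by
  have key : ∀ x y, Disjoint (orbitalNeighbors G a b x) (orbitalNeighbors G a b y) →
      orbitalNeighbors G a b x ⊆ distinguishers G x y := by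
    intro x y hd c hc
    have hc' := disjoint_left.mp hd hc
    contrapose! hc'
    obtain ⟨h, hG, e, rfl⟩ := notMem_distinguishers.mp hc'
    simpa [e] using apply_mem_orbitalNeighbors hG hc
  have hu := card_le_card (union_subset (key x y hdisj)
    (distinguishers_comm (G := G) x y ▸ key y x hdisj.symm))
  rw [card_union_of_disjoint hdisj, card_orbitalNeighbors h1 a b x z,
    card_orbitalNeighbors h1 a b y z] at hu
  omega

/-- Every proper nonempty set is left by some edge of each nondiagonal orbital of a primitive
group. -/
theorem exists_apply_mem_apply_notMem {α : Type*} [Fintype α] {G : Subgroup (Perm α)}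
    (hprim : MulAction.IsPreprimitive G α) {S : Set α} (hS : S.Nonempty) (hS' : S ≠ Set.univ)
    {a b : α} (hab : a ≠ b) : ∃ h ∈ G, h a ∈ S ∧ h b ∉ S := by
  obtain ⟨k, ha, hb⟩ :=
    MulAction.IsPreprimitive.exists_mem_smul_and_notMem_smul (G := G) S.toFinite hS hS' hab
  rw [Set.mem_smul_set_iff_inv_smul_mem] at ha hb
  exact ⟨(k⁻¹ : G), (k⁻¹).2, ha, hb⟩

theorem card_le_card_orbitalNeighbors_mul (hprim : MulAction.IsPreprimitive G α) {a b : α}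
    (hab : a ≠ b) (x : α) :
    Fintype.card α ≤ #(orbitalNeighbors G a b x) * #(distinguishers G a b) := by
  have hcover : (univ : Finset α) ⊆
      (orbitalNeighbors G a b x).biUnion fun y => distinguishers G x y := by
    intro c _
    set S : Set α := {z | c ∉ distinguishers G x z}
    have hxS : x ∈ S := notMem_distinguishers.mpr ⟨1, G.one_mem, rfl, rfl⟩
    have hSuniv : S ≠ Set.univ := by
      intro e
      have hmem : ∀ z, z ∈ S := fun z => e ▸ Set.mem_univ z
      obtain ⟨h, -, hc, hx⟩ := notMem_distinguishers.mp (hmem c)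
      have hxc : x = c := h.injective (hx.trans hc.symm)
      have hall : ∀ z, z = c := by
        intro z
        obtain ⟨k, -, kc, kx⟩ := notMem_distinguishers.mp (hmem z)
        rw [← kx, hxc, kc]
      exact hab ((hall a).trans (hall b).symm)
    obtain ⟨h, hG, ha, hb⟩ := exists_apply_mem_apply_notMem hprim ⟨x, hxS⟩ hSuniv hab
    obtain ⟨k, kG, kc, kx⟩ := notMem_distinguishers.mp ha
    rw [mem_biUnion]
    refine ⟨k⁻¹ (h b), mem_orbitalNeighbors.mpr ⟨k⁻¹ * h, G.mul_mem (G.inv_mem kG) hG, ?_, rfl⟩,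
      ?_⟩
    · rw [Perm.mul_apply, ← kx, perm_inv_apply_apply]
    · by_contra hcon
      obtain ⟨l, lG, lc, lx⟩ := notMem_distinguishers.mp hcon
      refine hb (notMem_distinguishers.mpr ⟨k * l, G.mul_mem kG lG, ?_, ?_⟩)
      · rw [Perm.mul_apply, lc, kc]
      · rw [Perm.mul_apply, lx, perm_apply_inv_apply]
  rw [← card_univ]
  exact (card_le_card hcover).trans (card_biUnion_le_card_mul _ _ _ fun y hy =>
    (card_distinguishers_of_mem_orbitalNeighbors hy).le)

/-- Averaging over all pairs bounds the valency of a small orbital by the largest number of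
distinguishers. -/
theorem card_orbitalNeighbors_le_of_forall (h1 : ∀ a c : α, ∃ h ∈ G, h a = c) {M : ℕ}
    (hM : ∀ x y, #(distinguishers G x y) ≤ M) (a b : α)
    (hq : 2 * #(orbitalNeighbors G a b a) ≤ Fintype.card α) :
    #(orbitalNeighbors G a b a) ≤ M := by
  have hn : 0 < Fintype.card α := Fintype.card_pos_iff.mpr ⟨a⟩
  have hcomm := sum_card_bipartiteAbove_eq_sum_card_bipartiteBelow
    (s := (univ : Finset (α × α))) (t := (univ : Finset α))
    (fun p c => c ∈ distinguishers G p.1 p.2)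
  simp only [bipartiteAbove, bipartiteBelow, filter_univ_mem] at hcomm
  have hupper : ∑ p : α × α, #(distinguishers G p.1 p.2) ≤
      Fintype.card α * Fintype.card α * M := by
    refine (sum_le_card_nsmul _ _ M fun p _ => hM p.1 p.2).trans ?_
    simp [Fintype.card_prod]
  have hlower : Fintype.card α *
      (2 * (#(orbitalNeighbors G a b a) * (Fintype.card α - #(orbitalNeighbors G a b a)))) ≤
      ∑ c : α, #{p : α × α | c ∈ distinguishers G p.1 p.2} := by
    rw [← card_univ (α := α), ← smul_eq_mul]
    refine card_nsmul_le_sum _ _ _ fun c _ => ?_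
    set Q := orbitalNeighbors G a b c with hQ
    have hdisj : Disjoint (Q ×ˢ Qᶜ) (Qᶜ ×ˢ Q) := by
      rw [disjoint_left]
      rintro ⟨x, y⟩ hx hy
      simp only [mem_product, mem_compl] at hx hy
      exact hy.1 hx.1
    have hsub : Q ×ˢ Qᶜ ∪ Qᶜ ×ˢ Q ⊆
        ({p : α × α | c ∈ distinguishers G p.1 p.2} : Finset (α × α)) := by
      rintro ⟨x, y⟩ hxy
      simp only [mem_union, mem_product, mem_compl] at hxy
      simp only [mem_filter, mem_univ, true_and]
      rcases hxy with ⟨hx, hy⟩ | ⟨hx, hy⟩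
      · exact mem_distinguishers_of_orbitalNeighbors hx hy
      · rw [distinguishers_comm]
        exact mem_distinguishers_of_orbitalNeighbors hy hx
    have hcard := card_le_card hsub
    rw [card_union_of_disjoint hdisj, card_product, card_product, card_compl, hQ,
      card_orbitalNeighbors h1 a b c a] at hcard
    rw [card_univ]
    linarith [mul_comm #(orbitalNeighbors G a b a)
      (Fintype.card α - #(orbitalNeighbors G a b a))]
  rw [← hcomm] at hlower
  have hle := hlower.trans hupper
  generalize #(orbitalNeighbors G a b a) = q at *
  generalize Fintype.card α = n at *
  obtain ⟨r, rfl⟩ : ∃ r, n = q + r := ⟨n - q, by omega⟩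
  rw [Nat.add_sub_cancel_left, mul_assoc] at hle
  have h2 := Nat.le_of_mul_le_mul_left hle hn
  have h3 : (q + r) * q ≤ 2 * (q * r) := by nlinarith
  exact Nat.le_of_mul_le_mul_left (h3.trans h2) hn

theorem exists_two_mul_card_orbitalNeighbors_le (h1 : ∀ a c : α, ∃ h ∈ G, h a = c)
    (h2 : ¬ ∀ a b c d : α, a ≠ b → c ≠ d → ∃ h ∈ G, h a = c ∧ h b = d) :
    ∃ a b : α, a ≠ b ∧ 2 * #(orbitalNeighbors G a b a) ≤ Fintype.card α := by
  push Not at h2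
  obtain ⟨a, b, c, d, hab, hcd, hno⟩ := h2
  have hdisj : Disjoint (orbitalNeighbors G a b c) (orbitalNeighbors G c d c) := by
    rw [disjoint_left]
    intro y hy hy'
    obtain ⟨h, hG, ha, hb⟩ := mem_orbitalNeighbors.mp hy
    obtain ⟨k, kG, kc, kd⟩ := mem_orbitalNeighbors.mp hy'
    refine hno (k⁻¹ * h) (G.mul_mem (G.inv_mem kG) hG) ?_ ?_
    · rw [Perm.mul_apply, ha, Perm.inv_eq_iff_eq, kc]
    · rw [Perm.mul_apply, hb, Perm.inv_eq_iff_eq, kd]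
  have hsum := card_le_univ (orbitalNeighbors G a b c ∪ orbitalNeighbors G c d c)
  rw [card_union_of_disjoint hdisj, card_orbitalNeighbors h1 a b c a] at hsum
  rcases le_total #(orbitalNeighbors G a b a) #(orbitalNeighbors G c d c) with hle | hle
  · exact ⟨a, b, hab, by omega⟩
  · exact ⟨c, d, hcd, by omega⟩

/-- A primitive group of degree `n` which is not doubly transitive has minimal degree at least
`√n / 2`. -/
theorem card_le_four_mul_sq_card_support (hprim : MulAction.IsPreprimitive G α)
    (h1 : ∀ a c : α, ∃ h ∈ G, h a = c)
    (h2 : ¬ ∀ a b c d : α, a ≠ b → c ≠ d → ∃ h ∈ G, h a = c ∧ h b = d)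
    {g : Perm α} (hg : g ∈ G) (hg1 : g ≠ 1) :
    Fintype.card α ≤ 4 * #g.support ^ 2 := by
  obtain ⟨a, ha⟩ : ∃ a, g a ≠ a := by
    contrapose! hg1
    exact Perm.ext hg1
  have hm : #(distinguishers G a (g a)) ≤ #g.support :=
    card_le_card (distinguishers_apply_subset_support hg a)
  have hedge : ∀ x y, y ∈ orbitalNeighbors G a (g a) x → #(distinguishers G x y) ≤ #g.support :=
    fun x y hy => (card_distinguishers_of_mem_orbitalNeighbors hy).trans_le hm
  have hnear : ∀ x y, ¬ Disjoint (orbitalNeighbors G a (g a) x) (orbitalNeighbors G a (g a) y) →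
      #(distinguishers G x y) ≤ 2 * #g.support := by
    intro x y hxy
    obtain ⟨z, hx, hy⟩ := not_disjoint_iff.mp hxy
    have ht := card_distinguishers_triangle (G := G) x z y
    have hzx := hedge x z hx
    have hzy := hedge y z hy
    rw [distinguishers_comm] at hzy
    omega
  by_cases hall : ∀ x y,
      ¬ Disjoint (orbitalNeighbors G a (g a) x) (orbitalNeighbors G a (g a) y)
  · obtain ⟨c, d, hcd, hq⟩ := exists_two_mul_card_orbitalNeighbors_le h1 h2
    have hle := card_orbitalNeighbors_le_of_forall h1 (fun x y => hnear x y (hall x y)) c d hq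
    calc Fintype.card α ≤ #(orbitalNeighbors G c d c) * #(distinguishers G c d) :=
          card_le_card_orbitalNeighbors_mul hprim hcd c
      _ ≤ (2 * #g.support) * (2 * #g.support) := Nat.mul_le_mul hle (hnear c d (hall c d))
      _ = 4 * #g.support ^ 2 := by ring
  · push Not at hall
    obtain ⟨x, y, hxy⟩ := hall
    have hnbr : (orbitalNeighbors G a (g a) x).Nonempty := by
      obtain ⟨h, hG, e⟩ := h1 a x
      exact ⟨h (g a), mem_orbitalNeighbors.mpr ⟨h, hG, e, rfl⟩⟩
    obtain ⟨h, hG, hS, hS'⟩ := exists_apply_mem_apply_notMem hprim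
      (S := {z | ¬ Disjoint (orbitalNeighbors G a (g a) x) (orbitalNeighbors G a (g a) z)})
      ⟨x, by simpa [disjoint_self_iff_empty] using hnbr.ne_empty⟩
      (fun e => (e ▸ Set.mem_univ y : y ∈ {z | ¬ Disjoint _ _}) hxy) ha.symm
    have hdisj := not_not.mp hS'
    have hk := two_mul_card_orbitalNeighbors_le h1 hdisj a
    have ht := card_distinguishers_triangle (G := G) x (h a) (h (g a))
    have hx := hnear x (h a) hS
    have hy := hedge (h a) (h (g a)) (mem_orbitalNeighbors.mpr ⟨h, hG, rfl, rfl⟩)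
    calc Fintype.card α ≤ #(orbitalNeighbors G a (g a) a) * #(distinguishers G a (g a)) :=
          card_le_card_orbitalNeighbors_mul hprim ha.symm a
      _ ≤ (2 * #g.support) * #g.support := Nat.mul_le_mul (by omega) hm
      _ ≤ 4 * #g.support ^ 2 := by nlinarith

end PrimitiveGroup

/-- If `G ≤ Sₙ` is a primitive permutation group (transitive with no nontrivial blocks)
not containing the alternating group, then every nonidentity element of `G` moves at
least `(√n − 1)/2` points. -/
theorem stmt13 (n : ℕ) (G : Subgroup (Equiv.Perm (Fin n)))
    (htrans : MulAction.IsPretransitive G (Fin n))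
    (hprim : ∀ B : Set (Fin n), MulAction.IsBlock G B → B.Subsingleton ∨ B = Set.univ)
    (hA : ¬ alternatingGroup (Fin n) ≤ G) :
    ∀ g ∈ G, g ≠ 1 → (Real.sqrt n - 1) / 2 ≤ (g.support.card : ℝ) := by
  intro g hg hg1
  have hp : MulAction.IsPreprimitive G (Fin n) :=
    { toIsPretransitive := htrans, isTrivialBlock_of_isBlock := fun hB => hprim _ hB }
  have h1 : ∀ a c : Fin n, ∃ h ∈ G, h a = c := by
    intro a c
    obtain ⟨h, e⟩ := htrans.exists_smul_eq a c
    exact ⟨h, h.2, e⟩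
  have hn : n ≤ (2 * g.support.card + 1) ^ 2 := by
    by_cases h2 : ∀ a b c d : Fin n, a ≠ b → c ≠ d → ∃ h ∈ G, h a = c ∧ h b = d
    · by_contra! hlt
      refine hA (PrimitiveGroup.alternatingGroup_le_of_two_transitive hp h1 h2 hg hg1 ?_)
      rw [Fintype.card_fin]
      have hsq : (g.support.card - 1) ^ 2 ≤ g.support.card ^ 2 :=
        Nat.pow_le_pow_left (Nat.sub_le _ _) 2
      nlinarith [Nat.zero_le g.support.card]
    · have hle := PrimitiveGroup.card_le_four_mul_sq_card_support hp h1 h2 hg hg1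
      rw [Fintype.card_fin] at hle
      nlinarith [Nat.zero_le g.support.card]
  have hsqrt : Real.sqrt n ≤ 2 * (g.support.card : ℝ) + 1 :=
    Real.sqrt_le_iff.mpr ⟨by positivity, by exact_mod_cast hn⟩
  linarith
end

section
/- Let f ∈ ℤ[X] be a monic polynomial of degree n and p a prime such that the reduction of f modulo p is squarefree. If the Frobenius acting on the roots of f mod p (equivalently, the factorization type of f mod p) has cycle lengths equal to the degrees of the irreducible factors of f mod p, then the Galois group of f over ℚ contains a permutation of the roots whose cycle type equals the multiset of degrees of the irreducible factors of f mod p. -/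
open Polynomial

open scoped Classical

attribute [local instance] Polynomial.Gal.splits_ℚ_ℂ

/-- If `h b` is the size of the fibre of `m` over each `b ∈ s`, then the number of elements lying in
fibres of size `d` is `d` times the number of such fibres. -/
theorem card_filter_eq_mul_count {α β : Type*} [DecidableEq β] (m : α → β) (t : Finset α)
    (s : Finset β) (h : β → ℕ) (hms : ∀ x ∈ t, m x ∈ s)
    (hh : ∀ b ∈ s, h b = (t.filter (m · = b)).card) (d : ℕ) :
    (t.filter (fun x ↦ h (m x) = d)).card = d * (s.val.map h).count d := by
  rw [Finset.card_eq_sum_card_fiberwise (f := m) (t := s.filter (h · = d))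
    fun x hx ↦ by simp_all, Finset.sum_congr rfl (g := fun _ ↦ d), Finset.sum_const, smul_eq_mul,
    mul_comm, Multiset.count_map, Finset.card_def, Finset.filter_val]
  · simp only [eq_comm]
  · intro b hb
    rw [Finset.mem_filter] at hb
    rw [← hb.2, hh b hb.1, Finset.filter_filter]
    congr 1
    ext x
    simp only [Finset.mem_filter, and_congr_right_iff, and_iff_right_iff_imp]
    rintro hx rfl
    exact hh _ hb.1

/-- If the fibres of `m` are the orbits of the permutation `σ`, then the cycle type of `σ`, fixed
points included, is the multiset of the sizes of the fibres of `m`. -/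
theorem Equiv.Perm.cycleType_add_replicate_eq_map_card_fiber {α β : Type*} [Fintype α]
    [DecidableEq α] (σ : Equiv.Perm α) (m : α → β) (hm : ∀ x y, σ.SameCycle x y ↔ m x = m y)
    (s : Finset β) (h : β → ℕ) (hms : ∀ x, m x ∈ s)
    (hh : ∀ b ∈ s, h b = (Finset.univ.filter (m · = b)).card) (hpos : ∀ b ∈ s, h b ≠ 0) :
    σ.cycleType + Multiset.replicate (Nat.card {x // σ x = x}) 1 = s.val.map h := by
  have hfix (x : α) : h (m x) = 1 ↔ σ x = x := by
    rw [hh _ (hms x), Finset.card_eq_one]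
    constructor
    · rintro ⟨a, ha⟩
      have h₁ : x ∈ ({a} : Finset α) := by simp [← ha]
      have h₂ : σ x ∈ ({a} : Finset α) := by
        simpa [← ha] using ((hm x (σ x)).1 ⟨1, by simp⟩).symm
      simp_all
    · intro hx
      refine ⟨x, ?_⟩
      ext y
      simp only [Finset.mem_filter, Finset.mem_univ, true_and, Finset.mem_singleton]
      refine ⟨fun hy ↦ ?_, fun hy ↦ hy ▸ rfl⟩
      obtain ⟨i, hi⟩ := (hm x y).2 hy.symm
      rw [← hi, Equiv.Perm.zpow_apply_eq_self_of_apply_eq_self hx]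
  have key := card_filter_eq_mul_count m Finset.univ s h (fun x _ ↦ hms x) hh
  ext d
  rcases Nat.lt_trichotomy d 1 with hd | rfl | hd
  · obtain rfl : d = 0 := by omega
    rw [Multiset.count_eq_zero_of_notMem, Multiset.count_eq_zero_of_notMem]
    · simpa using hpos
    · simp only [Multiset.mem_add, Multiset.mem_replicate, not_or]
      exact ⟨fun h0 ↦ by simpa using Equiv.Perm.two_le_of_mem_cycleType h0, by simp⟩
  · rw [Multiset.count_add, Multiset.count_replicate_self, Multiset.count_eq_zero_of_notMem
      fun h1 ↦ by simpa using Equiv.Perm.two_le_of_mem_cycleType h1, zero_add,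
      ← one_mul (Multiset.count _ _), ← key, Nat.card_eq_fintype_card, Fintype.card_subtype]
    simp only [hfix]
  · rw [Multiset.count_add, Multiset.count_replicate, if_neg hd.ne, add_zero]
    refine Nat.eq_of_mul_eq_mul_left (zero_lt_one.trans hd) ?_
    rw [← key, Equiv.Perm.cycleType_def,
      ← card_filter_eq_mul_count σ.cycleOf σ.support σ.cycleFactorsFinset]
    · congr 1
      ext x
      simp only [Finset.mem_filter, Finset.mem_univ, true_and, Function.comp_apply]
      by_cases hx : x ∈ σ.support
      · rw [and_iff_right hx, hh _ (hms x)]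
        have : (σ.cycleOf x).support = Finset.univ.filter (m · = m x) := by
          ext y
          rw [Equiv.Perm.mem_support_cycleOf_iff, and_iff_left hx, hm, eq_comm]
          simp
        rw [this]
      · rw [Equiv.Perm.mem_support, not_not] at hx
        have := (hfix x).2 hx
        simp only [Equiv.Perm.mem_support, hx, this, ne_eq, not_true_eq_false, false_and,
          false_iff]
        exact hd.ne
    · exact fun x hx ↦ Equiv.Perm.cycleOf_mem_cycleFactorsFinset_iff.2 hx
    · intro c hc
      simp only [Function.comp_apply]
      congr 1
      ext x
      rw [Finset.mem_filter]
      refine ⟨fun hx ↦ ⟨Equiv.Perm.mem_cycleFactorsFinset_support_le hc hx,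
        (Equiv.Perm.cycle_is_cycleOf hx hc).symm⟩, ?_⟩
      rintro ⟨hx, rfl⟩
      exact Equiv.Perm.mem_support_cycleOf_iff.2 ⟨.refl _ _, hx⟩

/-- Over a finite field `k` of characteristic `p`, two elements have the same minimal polynomial
over the prime field iff they are in the same orbit of the Frobenius. -/
theorem ZMod.minpoly_eq_iff_exists_pow {p : ℕ} [Fact p.Prime] {k : Type*} [Field k] [Finite k]
    [Algebra (ZMod p) k] {x y : k} :
    minpoly (ZMod p) x = minpoly (ZMod p) y ↔ ∃ i : ℕ, x ^ p ^ i = y := by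
  have hpow (i : ℕ) (z : k) :
      (FiniteField.frobeniusAlgEquivOfAlgebraic (ZMod p) k ^ i) z = z ^ p ^ i := by
    simp [AlgEquiv.coe_pow, FiniteField.coe_frobeniusAlgEquivOfAlgebraic_iterate]
  constructor
  · intro h
    obtain ⟨τ, hτ⟩ := (isConjRoot_iff_exists_algEquiv (K := ZMod p)).1 (IsConjRoot.symm h)
    obtain ⟨i, rfl⟩ := (FiniteField.bijective_frobeniusAlgEquivOfAlgebraic_pow (ZMod p) k).2 τ
    exact ⟨i, by rw [← hpow]; exact hτ⟩
  · rintro ⟨i, rfl⟩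
    rw [← hpow, minpoly.algEquiv_eq]

/-- If `σ` acts as the Frobenius on the roots of a squarefree `F` over `ZMod p`, then its cycle type,
fixed points included, is the multiset of degrees of the irreducible factors of `F`. -/
theorem cycleType_add_replicate_eq_map_natDegree_factors {p : ℕ} [Fact p.Prime]
    {k : Type*} [Field k] [Finite k] [Algebra (ZMod p) k] {F : (ZMod p)[X]} (hF : F.Monic)
    (hsq : Squarefree F) (hsplit : (F.map (algebraMap (ZMod p) k)).Splits)
    {α : Type*} [Fintype α] [DecidableEq α] (σ : Equiv.Perm α) (ρ : α → k)
    (hρ : Function.Injective ρ) (hroot : ∀ z, aeval z F = 0 ↔ z ∈ Set.range ρ)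
    (hσ : ∀ x, ρ (σ x) = ρ x ^ p) :
    σ.cycleType + Multiset.replicate (Nat.card {x // σ x = x}) 1 =
      (UniqueFactorizationMonoid.factors F).map natDegree := by
  have hnd := (UniqueFactorizationMonoid.squarefree_iff_nodup_normalizedFactors hF.ne_zero).1 hsq
  have hmem (q : (ZMod p)[X]) : q ∈ UniqueFactorizationMonoid.normalizedFactors F ↔
      Irreducible q ∧ q.Monic ∧ q ∣ F := by
    rw [UniqueFactorizationMonoid.mem_normalizedFactors_iff' hF.ne_zero]
    refine and_congr_right fun hq ↦ and_congr_left fun _ ↦ ?_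
    exact (Polynomial.normalize_eq_self_iff_monic hq.ne_zero)
  have hpow (x : α) (i : ℕ) : ρ ((σ ^ i) x) = ρ x ^ p ^ i := by
    induction i with
    | zero => simp
    | succ i ih => rw [pow_succ', Equiv.Perm.mul_apply, hσ, ih, ← pow_mul, pow_succ]
  have hint (z : k) : IsIntegral (ZMod p) z := Algebra.IsIntegral.isIntegral z
  rw [Equiv.Perm.cycleType_add_replicate_eq_map_card_fiber σ (fun x ↦ minpoly (ZMod p) (ρ x)) ?_
    (UniqueFactorizationMonoid.normalizedFactors F).toFinset natDegree]
  · rw [Multiset.toFinset_val, hnd.dedup, UniqueFactorizationMonoid.normalizedFactors,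
      Multiset.map_map]
    exact Multiset.map_congr rfl fun q _ ↦ natDegree_eq_of_degree_eq degree_normalize
  · intro x
    rw [Multiset.mem_toFinset, hmem]
    exact ⟨minpoly.irreducible (hint _), minpoly.monic (hint _),
      minpoly.dvd _ _ ((hroot _).2 ⟨x, rfl⟩)⟩
  · intro q hq
    rw [Multiset.mem_toFinset, hmem] at hq
    obtain ⟨hirr, hmon, hdvd⟩ := hq
    have hsplit' : (q.map (algebraMap (ZMod p) k)).Splits :=
      hsplit.of_dvd (hF.map _).ne_zero (Polynomial.map_dvd _ hdvd)
    rw [← card_rootSet_eq_natDegree (PerfectField.separable_of_irreducible hirr) hsplit',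
      ← Set.toFinset_card, ← Finset.card_image_of_injective _ hρ]
    congr 1
    ext z
    simp only [Set.mem_toFinset, mem_rootSet, Finset.mem_image, Finset.mem_filter,
      Finset.mem_univ, true_and, ne_eq, hirr.ne_zero, not_false_eq_true]
    constructor
    · intro hz
      obtain ⟨x, rfl⟩ := (hroot z).1 (aeval_eq_zero_of_dvd_aeval_eq_zero hdvd hz)
      exact ⟨x, (minpoly.eq_of_irreducible_of_monic hirr hz hmon).symm, rfl⟩
    · rintro ⟨x, rfl, rfl⟩
      exact minpoly.aeval _ _
  · intro q hq
    rw [Multiset.mem_toFinset, hmem] at hq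
    exact hq.1.natDegree_pos.ne'
  · intro x y
    rw [ZMod.minpoly_eq_iff_exists_pow]
    constructor
    · intro h
      obtain ⟨i, rfl⟩ := h.exists_nat_pow_eq
      exact ⟨i, (hpow x i).symm⟩
    · rintro ⟨i, hi⟩
      exact ⟨i, hρ (by rw [zpow_natCast, hpow, hi])⟩

open NumberField in
/-- A Frobenius element exists at some prime of `𝓞 K` above `p`. -/
theorem NumberField.exists_gal_frobenius (K : Type*) [Field K] [NumberField K] [IsGalois ℚ K]
    (p : ℕ) [hp : Fact p.Prime] :
    ∃ (Q : Ideal (𝓞 K)) (g : Gal(K/ℚ)), Q.IsMaximal ∧ (p : 𝓞 K) ∈ Q ∧ Finite (𝓞 K ⧸ Q) ∧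
      ∀ x : 𝓞 K, Ideal.Quotient.mk Q (g • x) = Ideal.Quotient.mk Q x ^ p := by
  have := Int.ideal_span_isMaximal_of_prime p
  obtain ⟨Q, hQ, hQp⟩ := Ideal.exists_maximal_ideal_liesOver_of_isIntegral (S := 𝓞 K)
    (Ideal.span {(p : ℤ)})
  have hpQ : (p : 𝓞 K) ∈ Q := by
    have : (p : ℤ) ∈ Q.under ℤ := hQp.over ▸ Ideal.mem_span_singleton_self _
    simpa using this
  have : Finite (𝓞 K ⧸ Q) := by
    refine Ideal.finiteQuotientOfFreeOfNeBot Q ?_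
    rintro rfl
    exact hp.out.ne_zero (by simpa using hpQ)
  obtain ⟨g, hg⟩ := IsArithFrobAt.exists_of_isInvariant ℤ Gal(K/ℚ) Q
  refine ⟨Q, g, hQ, hpQ, this, fun x ↦ ?_⟩
  have := hg.mk_apply x
  rwa [← hQp.over, Int.card_ideal_quot] at this

open NumberField in
/-- If `f` splits in `K`, then the roots of `f` in `K`, considered as integers, provide the
factorization of `f` over `𝓞 K`. -/
theorem NumberField.exists_multiset_map_eq_prod {K : Type*} [Field K] [NumberField K] {f : ℤ[X]}
    (hf : f.Monic) (hsplit : (f.map (Int.castRingHom K)).Splits) :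
    ∃ M : Multiset (𝓞 K), f.map (Int.castRingHom (𝓞 K)) = (M.map (X - C ·)).prod := by
  have hlift : ∀ a ∈ (f.map (Int.castRingHom K)).roots, ∃ b : 𝓞 K, (b : K) = a := by
    intro a ha
    rw [mem_roots', IsRoot.def, eval_map] at ha
    exact ⟨⟨a, f, hf, ha.2⟩, rfl⟩
  obtain ⟨M, hM⟩ : ∃ M : Multiset (𝓞 K),
      M.map (algebraMap (𝓞 K) K) = (f.map (Int.castRingHom K)).roots := by
    choose! b hb using hlift
    refine ⟨(f.map (Int.castRingHom K)).roots.map b, ?_⟩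
    rw [Multiset.map_map]
    exact (Multiset.map_congr rfl fun a ha ↦ hb a ha).trans (Multiset.map_id _)
  refine ⟨M, map_injective _ (RingOfIntegers.coe_injective (K := K)) ?_⟩
  rw [map_map, Polynomial.map_multiset_prod, Multiset.map_map]
  have := hsplit.eq_prod_roots_of_monic (hf.map _)
  rw [← hM, Multiset.map_map] at this
  simpa [Function.comp_def, RingHom.eq_intCast'] using this

open NumberField in
/-- If `f` splits in `K` and is squarefree modulo `p`, then some element of the Galois group of `K`
permutes the roots of `f` with cycle type given by the factorization of `f` modulo `p`. -/
theorem NumberField.exists_gal_cycleType_add_replicate_eq (K : Type*) [Field K] [NumberField K]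
    [A : Algebra ℚ K] [IsGalois ℚ K] {f : ℤ[X]} (hf : f.Monic)
    (hsplit : (f.map (Int.castRingHom K)).Splits) (p : ℕ) [Fact p.Prime] (hsq : Squarefree (f.map (Int.castRingHom (ZMod p)))) :
    ∃ g : Gal(K/ℚ), ∀ {α : Type*} [Fintype α] [DecidableEq α] (σ : Equiv.Perm α) (r : α → K),
      Function.Injective r → (∀ z, eval₂ (Int.castRingHom K) z f = 0 ↔ z ∈ Set.range r) →
      (∀ x, r (σ x) = g (r x)) →
      σ.cycleType + Multiset.replicate (Nat.card {x // σ x = x}) 1 =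
        (UniqueFactorizationMonoid.factors (f.map (Int.castRingHom (ZMod p)))).map natDegree := by
  obtain rfl : A = DivisionRing.toRatAlgebra := Subsingleton.elim _ _
  obtain ⟨Q, g, hQ, hpQ, hfin, hg⟩ := exists_gal_frobenius K p
  refine ⟨g, fun {α} _ _ σ r hr hroot hσ ↦ ?_⟩
  let := Ideal.Quotient.field Q
  have : CharP (𝓞 K ⧸ Q) p := by
    refine (CharP.charP_iff_prime_eq_zero Fact.out).2 ?_
    exact_mod_cast Ideal.Quotient.eq_zero_iff_mem.2 hpQ
  let : Algebra (ZMod p) (𝓞 K ⧸ Q) := ZMod.algebra _ p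
  obtain ⟨M, hM⟩ := exists_multiset_map_eq_prod hf hsplit
  set F := f.map (Int.castRingHom (ZMod p)) with hFdef
  have hFM : F.map (algebraMap (ZMod p) (𝓞 K ⧸ Q)) =
      ((M.map (Ideal.Quotient.mk Q)).map (X - C ·)).prod := by
    have := congrArg (Polynomial.map (Ideal.Quotient.mk Q)) hM
    rw [Polynomial.map_multiset_prod, Multiset.map_map, map_map] at this
    rw [hFdef, map_map, Multiset.map_map, RingHom.ext_int ((algebraMap (ZMod p) _).comp _)
      ((Ideal.Quotient.mk Q).comp (Int.castRingHom (𝓞 K))), this]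
    exact congrArg Multiset.prod (Multiset.map_congr rfl fun a _ ↦ by simp)
  have hroots : (F.map (algebraMap (ZMod p) (𝓞 K ⧸ Q))).roots = M.map (Ideal.Quotient.mk Q) := by
    rw [hFM, roots_multiset_prod_X_sub_C]
  have hFmonic : F.Monic := hf.map _
  have hnodup : (M.map (Ideal.Quotient.mk Q)).Nodup :=
    hroots ▸ nodup_roots ((PerfectField.separable_iff_squarefree.2 hsq).map)
  have hMroot (a : 𝓞 K) : eval₂ (Int.castRingHom K) a f = 0 ↔ a ∈ M := by
    have h₁ : eval₂ (Int.castRingHom K) a f = algebraMap (𝓞 K) K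
        ((f.map (Int.castRingHom (𝓞 K))).eval a) := by
      rw [eval_map, hom_eval₂]
      congr 1
    rw [h₁, map_eq_zero_iff _ (RingOfIntegers.coe_injective (K := K)), hM, ← IsRoot.def,
      ← mem_roots (monic_multiset_prod_of_monic _ _ fun a _ ↦ monic_X_sub_C a).ne_zero,
      roots_multiset_prod_X_sub_C]
  let r' (x : α) : 𝓞 K := ⟨r x, f, hf, (hroot _).2 ⟨x, rfl⟩⟩
  have hr'M (x : α) : r' x ∈ M := (hMroot _).1 ((hroot _).2 ⟨x, rfl⟩)
  have hr'σ (x : α) : r' (σ x) = g • r' x := RingOfIntegers.ext (hσ x)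
  refine cycleType_add_replicate_eq_map_natDegree_factors (k := 𝓞 K ⧸ Q) hFmonic hsq ?_ σ
    (fun x ↦ Ideal.Quotient.mk Q (r' x)) ?_ ?_ fun x ↦ by rw [hr'σ, hg]
  · rw [hFM]
    exact Splits.multisetProd fun q hq ↦ by
      obtain ⟨a, -, rfl⟩ := Multiset.mem_map.1 hq
      exact Splits.X_sub_C a
  · intro x y hxy
    exact hr (congrArg (algebraMap (𝓞 K) K)
      (Multiset.inj_on_of_nodup_map hnodup _ (hr'M x) _ (hr'M y) hxy))
  · intro z
    rw [aeval_def, ← eval_map, ← IsRoot.def, ← mem_roots (hFmonic.map _).ne_zero, hroots,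
      Multiset.mem_map]
    constructor
    · rintro ⟨a, ha, rfl⟩
      obtain ⟨x, hx⟩ := (hroot _).1 ((hMroot a).2 ha)
      exact ⟨x, congrArg _ (RingOfIntegers.ext hx)⟩
    · rintro ⟨x, rfl⟩
      exact ⟨_, hr'M x, rfl⟩

/-- Dedekind's theorem: if `f ∈ ℤ[X]` is monic of degree `n` and `p` is a prime such that
`f mod p` is squarefree, then the Galois group of `f` over `ℚ`, acting on the complex
roots of `f`, contains a permutation whose cycle type (with fixed points counted as
cycles of length 1) equals the multiset of degrees of the irreducible factors of
`f mod p`. -/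
theorem stmt16 (n : ℕ) (f : Polynomial ℤ) (hmonic : f.Monic) (hdeg : f.natDegree = n)
    (p : ℕ) [hp : Fact p.Prime]
    (hsqfree : Squarefree (f.map (Int.castRingHom (ZMod p)))) :
    ∃ g : ((f.map (Int.castRingHom ℚ)).Gal),
      (Polynomial.Gal.galActionHom (f.map (Int.castRingHom ℚ)) ℂ g).cycleType
          + Multiset.replicate
              (Nat.card {y : ((f.map (Int.castRingHom ℚ)).rootSet ℂ) //
                Polynomial.Gal.galActionHom (f.map (Int.castRingHom ℚ)) ℂ g y = y}) 1
        = Multiset.map Polynomial.natDegree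
            (UniqueFactorizationMonoid.factors (f.map (Int.castRingHom (ZMod p)))) := by
  have hne : f.map (Int.castRingHom ℚ) ≠ 0 := (hmonic.map _).ne_zero
  have hcomp (L : Type) [Field L] [Algebra ℚ L] :
      (algebraMap ℚ L).comp (Int.castRingHom ℚ) = Int.castRingHom L := RingHom.ext_int _ _
  have hmap (L : Type) [Field L] [Algebra ℚ L] :
      f.map (Int.castRingHom L) = (f.map (Int.castRingHom ℚ)).map (algebraMap ℚ L) := by
    rw [map_map, hcomp]
  have haeval (L : Type) [Field L] [Algebra ℚ L] (z : L) :
      aeval z (f.map (Int.castRingHom ℚ)) = eval₂ (Int.castRingHom L) z f := by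
    rw [aeval_def, eval₂_map, hcomp]
  generalize f.map (Int.castRingHom ℚ) = P at *
  have hsf := IsSplittingField.splittingField P
  have hnormal := Normal.of_isSplittingField (hFEp := hsf)
  have halg := hnormal.toIsAlgebraic
  have hgal := @IsGalois.mk _ _ _ _ _ halg.isSeparable_of_perfectField hnormal
  have : NumberField P.SplittingField := ⟨⟩
  obtain ⟨g, hg⟩ := @NumberField.exists_gal_cycleType_add_replicate_eq P.SplittingField
    _ _ _ hgal f hmonic (hmap P.SplittingField ▸ hsf.splits) p _ hsqfree
  refine ⟨g, ?_⟩
  convert hg (Polynomial.Gal.galActionHom P ℂ g)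
    (fun y ↦ ((Polynomial.Gal.rootsEquivRoots P ℂ).symm y : P.SplittingField)) ?_ ?_ ?_
  · exact Subtype.val_injective.comp (Equiv.injective _)
  · intro z
    rw [← haeval]
    constructor
    · intro h
      exact ⟨Polynomial.Gal.rootsEquivRoots P ℂ ⟨z, mem_rootSet.2 ⟨hne, h⟩⟩, by simp⟩
    · rintro ⟨y, rfl⟩
      exact (mem_rootSet.1 (Subtype.prop _)).2
  · intro y
    exact congrArg Subtype.val (Equiv.symm_apply_apply (Polynomial.Gal.rootsEquivRoots P ℂ) _)
end
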